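/- Let {x_k}_{k=1}^m be a frame for ℝⁿ. The following are equivalent: (1) the only self-adjoint operator T on ℝⁿ with trace zero satisfying ⟨T x_k, x_k⟩ = 0 for all k = 1,…,m is T = 0 (equivalently, any two self-adjoint trace-one operators giving the same measurements ⟨T x_k, x_k⟩ are equal); (2) the family {x̃_k}_{k=1}^m spans ℝ^{n(n+1)/2 − 1}. -/

import Mathlib

open scoped InnerProductSpace

/-- For `x ∈ ℝⁿ`, the vector `x̃ ∈ ℝ^{n(n+1)/2 - 1}`, whose entries are the
products `x_i x_j` for `i < j` together with the differences `x_i² - x_1²`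
for `i ≥ 2` (indices `0`-based: `i ≥ 1`). -/
def tildeVecRTrace {n : ℕ} (hn : 0 < n) (x : EuclideanSpace ℝ (Fin n)) :
    ({p : Fin n × Fin n // p.1 < p.2} ⊕ {i : Fin n // 0 < (i : ℕ)}) → ℝ :=
  Sum.elim (fun p => x p.1.1 * x p.1.2)
    (fun i => x i.1 ^ 2 - x ⟨0, hn⟩ ^ 2)

theorem tr_aux {n : ℕ} (M : Matrix (Fin n) (Fin n) ℝ) : LinearMap.trace ℝ (EuclideanSpace ℝ (Fin n)) (Matrix.toEuclideanCLM (𝕜 := ℝ) M).toLinearMap = M.trace := by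
  rw [LinearMap.trace_eq_matrix_trace ℝ (EuclideanSpace.basisFun (Fin n) ℝ).toBasis]
  congr 1
  ext i j
  simp [LinearMap.toMatrix_apply, Matrix.ofLp_toEuclideanCLM]

theorem inner_aux {n : ℕ} (M : Matrix (Fin n) (Fin n) ℝ) (v : EuclideanSpace ℝ (Fin n)) : ⟪Matrix.toEuclideanCLM (𝕜 := ℝ) M v, v⟫_ℝ = ∑ i, ∑ j, M i j * v i * v j := by
  simp [PiLp.inner_apply, Matrix.ofLp_toEuclideanCLM, Matrix.mulVec, dotProduct, Finset.mul_sum]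
  refine Finset.sum_congr rfl fun i _ => Finset.sum_congr rfl fun j _ => by ring

theorem sum_sym_aux {n : ℕ} (f : Fin n → Fin n → ℝ) (hf : ∀ i j, f i j = f j i) : ∑ i, ∑ j, f i j = (∑ p : {p : Fin n × Fin n // p.1 < p.2}, 2 * f p.1.1 p.1.2) + ∑ i, f i i := by
  have h1 : (∑ p : {p : Fin n × Fin n // p.1 < p.2}, 2 * f p.1.1 p.1.2) = ∑ i, ∑ j, if i < j then 2 * f i j else 0 := by
    rw [← Finset.sum_product', Finset.univ_product_univ, ← Finset.sum_filter]
    exact (Finset.sum_subtype _ (by simp) (fun p : Fin n × Fin n => 2 * f p.1 p.2)).symm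
  have h2 : ∑ i, f i i = ∑ i, ∑ j, if i = j then f i j else 0 := by simp
  have h3 : ∑ i, ∑ j, (if i < j then 2 * f i j else 0) = ∑ i, ∑ j, (if i < j then f i j else 0) + ∑ i, ∑ j, (if j < i then f i j else 0) := by
    rw [Finset.sum_comm (f := fun i j => if j < i then f i j else 0)]
    simp only [← Finset.sum_add_distrib]
    refine Finset.sum_congr rfl fun i _ => Finset.sum_congr rfl fun j _ => ?_
    rw [hf j i]; split_ifs <;> ring
  rw [h1, h2, h3]
  simp only [← Finset.sum_add_distrib]
  refine Finset.sum_congr rfl fun i _ => Finset.sum_congr rfl fun j _ => ?_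
  rcases lt_trichotomy i j with h | h | h
  · simp [h, h.not_gt, h.ne]
  · simp [h]
  · simp [h, h.not_gt, h.ne']

theorem sum_zero_aux {n : ℕ} (hn : 0 < n) (f : Fin n → ℝ) : ∑ i, f i = f ⟨0, hn⟩ + ∑ i : {i : Fin n // 0 < (i : ℕ)}, f i.1 := by
  rw [← Finset.add_sum_erase _ _ (Finset.mem_univ (⟨0, hn⟩ : Fin n))]
  congr 1
  exact Finset.sum_subtype _ (by simp [Fin.ext_iff, Nat.pos_iff_ne_zero]) f

def coefAux {n : ℕ} (M : Matrix (Fin n) (Fin n) ℝ) :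
    ({p : Fin n × Fin n // p.1 < p.2} ⊕ {i : Fin n // 0 < (i : ℕ)}) → ℝ :=
  Sum.elim (fun p => 2 * M p.1.1 p.1.2) (fun i => M i.1 i.1)

theorem quad_aux {n : ℕ} (hn : 0 < n) (M : Matrix (Fin n) (Fin n) ℝ)
    (hs : ∀ i j, M i j = M j i) (ht : M.trace = 0) (v : EuclideanSpace ℝ (Fin n)) :
    ⟪Matrix.toEuclideanCLM (𝕜 := ℝ) M v, v⟫_ℝ = ∑ s, tildeVecRTrace hn v s * coefAux M s := by
  rw [inner_aux, sum_sym_aux _ (fun i j => by rw [hs i j]; ring), sum_zero_aux hn,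
    Fintype.sum_sum_type]
  have ht' : M ⟨0, hn⟩ ⟨0, hn⟩ = - ∑ i : {i : Fin n // 0 < (i : ℕ)}, M i.1 i.1 := by
    have := sum_zero_aux hn (fun i => M i i)
    simp only [Matrix.trace, Matrix.diag] at ht
    linarith
  rw [ht']
  simp only [tildeVecRTrace, coefAux, Sum.elim_inl, Sum.elim_inr]
  congr 1
  · exact Finset.sum_congr rfl fun p _ => by ring
  · rw [← Finset.sum_neg_distrib, Finset.sum_mul, Finset.sum_mul, ← Finset.sum_add_distrib]
    exact Finset.sum_congr rfl fun p _ => by ring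

theorem coef_zero_aux {n : ℕ} (hn : 0 < n) (M : Matrix (Fin n) (Fin n) ℝ)
    (hs : ∀ i j, M i j = M j i) (ht : M.trace = 0) (hc : ∀ s, coefAux M s = 0) : M = 0 := by
  have hd : ∀ i : {i : Fin n // 0 < (i : ℕ)}, M i.1 i.1 = 0 := fun i => hc (Sum.inr i)
  have hl : ∀ i j, i < j → M i j = 0 := fun i j h => by
    have := hc (Sum.inl ⟨(i, j), h⟩)
    simp only [coefAux, Sum.elim_inl] at this
    linarith
  ext i j
  rcases lt_trichotomy i j with h | h | h
  · exact hl i j h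
  · subst h
    by_cases h0 : 0 < (i : ℕ)
    · exact hd ⟨i, h0⟩
    · have hi : i = ⟨0, hn⟩ := Fin.ext (by simpa using h0)
      have := sum_zero_aux hn (fun i => M i i)
      simp only [Matrix.trace, Matrix.diag] at ht
      rw [ht, Finset.sum_eq_zero (fun i _ => hd i)] at this
      rw [hi, Matrix.zero_apply]; linarith
  · rw [hs]; exact hl j i h

theorem exists_coef_aux {n : ℕ} (hn : 0 < n)
    (c : ({p : Fin n × Fin n // p.1 < p.2} ⊕ {i : Fin n // 0 < (i : ℕ)}) → ℝ) :
    ∃ M : Matrix (Fin n) (Fin n) ℝ, (∀ i j, M i j = M j i) ∧ M.trace = 0 ∧ coefAux M = c := by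
  let M : Matrix (Fin n) (Fin n) ℝ := fun i j =>
    if h : i < j then c (Sum.inl ⟨(i, j), h⟩) / 2
    else if h : j < i then c (Sum.inl ⟨(j, i), h⟩) / 2
    else if h : 0 < (i : ℕ) then c (Sum.inr ⟨i, h⟩)
    else - ∑ s, c (Sum.inr s)
  have hM : ∀ i : {i : Fin n // 0 < (i : ℕ)}, M i.1 i.1 = c (Sum.inr i) := by
    intro i; simp [M, i.2]
  refine ⟨M, ?_, ?_, ?_⟩
  · intro i j
    rcases lt_trichotomy i j with h | h | h
    · simp [M, h, h.not_gt]
    · rw [h]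
    · simp [M, h, h.not_gt]
  · have := sum_zero_aux hn (fun i => M i i)
    simp only [Matrix.trace, Matrix.diag]
    rw [this, Finset.sum_congr rfl (fun i _ => hM i)]
    simp [M]
  · funext s
    rcases s with p | i
    · have := p.2
      simp only [coefAux, Sum.elim_inl, M, dif_pos this]; ring
    · exact hM i

theorem sa_aux {n : ℕ} (M : Matrix (Fin n) (Fin n) ℝ) :
    IsSelfAdjoint (Matrix.toEuclideanCLM (𝕜 := ℝ) M) ↔ ∀ i j, M i j = M j i := by
  rw [IsSelfAdjoint, ← map_star, EmbeddingLike.apply_eq_iff_eq, Matrix.star_eq_conjTranspose,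
    ← Matrix.ext_iff]
  simp only [Matrix.conjTranspose_apply, star_trivial]
  exact ⟨fun h i j => h j i, fun h i j => h j i⟩

/-- A frame `{x_k}_{k=1}^m` for `ℝⁿ` is injective for self-adjoint
trace-zero operators (equivalently, separates self-adjoint trace-one operators)
if and only if the family `{x̃_k}_{k=1}^m` spans `ℝ^{n(n+1)/2 - 1}`. -/
theorem stmt_3 {n m : ℕ} (hn : 0 < n) (x : Fin m → EuclideanSpace ℝ (Fin n))
    (hframe : ∃ A B : ℝ, 0 < A ∧ A ≤ B ∧ ∀ v : EuclideanSpace ℝ (Fin n),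
      A * ‖v‖ ^ 2 ≤ ∑ k, ⟪v, x k⟫_ℝ ^ 2 ∧ ∑ k, ⟪v, x k⟫_ℝ ^ 2 ≤ B * ‖v‖ ^ 2) :
    ((∀ T : EuclideanSpace ℝ (Fin n) →L[ℝ] EuclideanSpace ℝ (Fin n),
        IsSelfAdjoint T →
        LinearMap.trace ℝ (EuclideanSpace ℝ (Fin n)) T.toLinearMap = 0 →
        (∀ k, ⟪T (x k), x k⟫_ℝ = 0) → T = 0) ↔
      Submodule.span ℝ (Set.range fun k => tildeVecRTrace hn (x k)) = ⊤) := by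
  constructor
  · intro h
    by_contra hne
    obtain ⟨f, hf0, hf⟩ := Submodule.exists_le_ker_of_lt_top _ (lt_top_iff_ne_top.2 hne)
    obtain ⟨M, hs, ht, hc⟩ := exists_coef_aux hn (fun i => f fun j => if i = j then 1 else 0)
    have hM := h (Matrix.toEuclideanCLM (𝕜 := ℝ) M) ((sa_aux M).2 hs) ((tr_aux M).trans ht) (by
      intro k
      rw [quad_aux hn M hs ht, hc]
      have hk : f (tildeVecRTrace hn (x k)) = 0 := hf (Submodule.subset_span ⟨k, rfl⟩)
      rw [LinearMap.pi_apply_eq_sum_univ] at hk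
      exact hk)
    have hM0 : M = 0 := (map_eq_zero_iff _ (Matrix.toEuclideanCLM (𝕜 := ℝ)).injective).1 hM
    apply hf0
    refine LinearMap.ext fun v => ?_
    rw [LinearMap.pi_apply_eq_sum_univ]
    refine Finset.sum_eq_zero fun s _ => ?_
    have := congrFun hc s
    rw [← this, hM0]
    rcases s with s | s <;> simp [coefAux]
  · intro h T hT htr hk
    obtain ⟨M, rfl⟩ := EquivLike.surjective (Matrix.toEuclideanCLM (𝕜 := ℝ) (n := Fin n)) T
    have hs := (sa_aux M).1 hT
    have ht := (tr_aux M).symm.trans htr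
    let f : (({p : Fin n × Fin n // p.1 < p.2} ⊕ {i : Fin n // 0 < (i : ℕ)}) → ℝ) →ₗ[ℝ] ℝ :=
      Fintype.linearCombination ℝ (coefAux M)
    have hle : Submodule.span ℝ (Set.range fun k => tildeVecRTrace hn (x k)) ≤ f.ker := by
      rw [Submodule.span_le]
      rintro _ ⟨k, rfl⟩
      have := hk k
      rw [quad_aux hn M hs ht] at this
      simpa [f, Fintype.linearCombination_apply] using this
    rw [h] at hle
    rw [coef_zero_aux hn M hs ht, map_zero]
    intro s
    have : f (Pi.single s 1) = 0 := hle Submodule.mem_top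
    simpa [f] using this
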